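/- Setting L1 = L2 = L in the triple bounded identity recovers the double bounded identity; in particular, when L = M and the identity is combined with the q-Pfaff–Saalschütz summation, the right-hand side single sum ∑_{s≥0} q^{s(L+2) - T_s + T_{i-s} + T_{j-s} + T_{k-s}} C(L-s over s, i-s, j-s) C(L-i-j, k-s) equals q^{T_i + T_j + T_k} C(L-k, i) C(L-i, j) C(L-j, k). -/

import Mathlib

open Finset

noncomputable def q : RatFunc ℚ := RatFunc.X

/-- Triangular number `T m = m(m+1)/2` (integer division; note `T (-1) = 0`). -/
def T (m : ℤ) : ℤ := m * (m + 1) / 2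

/-- The Gaussian binomial coefficient `C(N, n) = (q^{N-n+1};q)_n / (q;q)_n` for
`n ≥ 0`, and `0` when out of range (`n < 0`).  For `0 ≤ N < n` the product
contains the factor `1 - q^0 = 0`, so it vanishes. -/
noncomputable def qbin (N n : ℤ) : RatFunc ℚ :=
  if n < 0 then 0
  else ∏ r ∈ Finset.range n.toNat, (1 - q ^ (N - (r : ℤ))) / (1 - q ^ ((r : ℤ) + 1))

theorem q_ne0 : q ≠ 0 := RatFunc.X_ne_zero

theorem q_pow_ne (n : ℕ) (hn : 0 < n) : q ^ n ≠ 1 := by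
  intro h
  have h2 : (algebraMap (Polynomial ℚ) (RatFunc ℚ)) (Polynomial.X ^ n)
      = (algebraMap (Polynomial ℚ) (RatFunc ℚ)) 1 := by
    rw [map_pow, map_one, RatFunc.algebraMap_X]; exact h
  have h3 := RatFunc.algebraMap_injective ℚ h2
  have h4 := congrArg Polynomial.natDegree h3
  simp at h4
  omega

theorem q_zpow_ne (m : ℤ) (hm : 0 < m) : 1 - q ^ m ≠ 0 := by
  intro h
  obtain ⟨n, rfl⟩ := Int.eq_ofNat_of_zero_le hm.le
  apply q_pow_ne n (by omega)
  have := (sub_eq_zero.mp h).symm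
  simpa using this

noncomputable def fq (m : ℤ) : RatFunc ℚ := ∏ r ∈ Finset.range m.toNat, (1 - q ^ ((r : ℤ) + 1))

noncomputable def rq (m : ℤ) : RatFunc ℚ := if m < 0 then 0 else (fq m)⁻¹

theorem fq_ne (m : ℤ) : fq m ≠ 0 := by
  unfold fq
  exact Finset.prod_ne_zero_iff.mpr fun r _ => q_zpow_ne _ (by omega)

theorem fq_step (m : ℤ) (hm : 0 ≤ m) : fq (m + 1) = (1 - q ^ (m + 1)) * fq m := by
  obtain ⟨n, rfl⟩ := Int.eq_ofNat_of_zero_le hm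
  unfold fq
  have h1 : ((n : ℤ) + 1).toNat = n + 1 := by omega
  have h2 : ((n : ℤ)).toNat = n := by omega
  rw [h1, h2, Finset.prod_range_succ, mul_comm]

theorem rq_neg (m : ℤ) (hm : m < 0) : rq m = 0 := by simp [rq, hm]

theorem rq_step (m : ℤ) : rq m = (1 - q ^ (m + 1)) * rq (m + 1) := by
  rcases lt_trichotomy m (-1) with h | h | h
  · rw [rq_neg _ (by omega), rq_neg _ (by omega)]; simp
  · subst h; rw [rq_neg _ (by omega)]; simp
  · unfold rq
    rw [if_neg (by omega), if_neg (by omega), fq_step m (by omega)]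
    have := fq_ne m
    have := q_zpow_ne (m + 1) (by omega)
    field_simp

theorem T_step (m : ℤ) : T (m + 1) = T m + m + 1 := by
  unfold T
  have : (m + 1) * (m + 1 + 1) = m * (m + 1) + (m + 1) * 2 := by ring
  rw [this, Int.add_mul_ediv_right _ _ (by norm_num)]
  ring

theorem qbin_neg (N n : ℤ) (h : n < 0) : qbin N n = 0 := by simp [qbin, h]

theorem qbin_nat (N : ℤ) (n : ℕ) (hN : 0 ≤ N) : qbin N n = fq N * rq n * rq (N - n) := by
  induction n with
  | zero =>
    have := fq_ne N
    simp [qbin, rq, not_lt.mpr hN]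
    rw [mul_right_comm, mul_inv_cancel₀ this]
    simp [fq]
  | succ n ih =>
    have h1 : qbin N ((n + 1 : ℕ) : ℤ)
        = qbin N n * ((1 - q ^ (N - (n : ℤ))) / (1 - q ^ ((n : ℤ) + 1))) := by
      unfold qbin
      rw [if_neg (by omega), if_neg (by omega)]
      have h1 : (((n + 1 : ℕ) : ℤ)).toNat = n + 1 := by omega
      have h2 : ((n : ℤ)).toNat = n := by omega
      rw [h1, h2, Finset.prod_range_succ]
    rw [h1, ih]
    have h2 := rq_step n
    have h3 := rq_step (N - (n + 1 : ℕ))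
    have h4 : N - ((n + 1 : ℕ) : ℤ) + 1 = N - n := by push_cast; ring
    rw [h4] at h3
    rw [h2, h3]
    have := q_zpow_ne ((n : ℤ) + 1) (by omega)
    push_cast
    field_simp

theorem qbin_eq (N n : ℤ) (hN : 0 ≤ N) : qbin N n = fq N * rq n * rq (N - n) := by
  rcases lt_or_ge n 0 with h | h
  · rw [qbin_neg _ _ h, rq_neg _ h]; simp
  · obtain ⟨n, rfl⟩ := Int.eq_ofNat_of_zero_le h
    exact qbin_nat N n hN

theorem rq_fq (n : ℤ) (hn : 0 ≤ n) : rq n * fq n = 1 := by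
  unfold rq
  rw [if_neg (by omega), inv_mul_cancel₀ (fq_ne n)]

/-- weight exponent -/
def ww (L i j k s : ℤ) : ℤ := s * (L + 2) - T s + T (i - s) + T (j - s) + T (k - s)

noncomputable def tt (L i j k s : ℤ) : RatFunc ℚ :=
  q ^ (ww L i j k s) * (fq (L - s) * rq s * rq (i - s) * rq (j - s) * rq (k - s)
    * rq (L - i - j - k + s))

noncomputable def GG (L i j k s : ℤ) : RatFunc ℚ :=
  - q ^ (ww L i j k s + (i + 1 - s)) * (fq (L + 1 - s) * rq (s - 1) * rq (i + 1 - s) * rq (j - s)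
    * rq (k - s) * rq (L - i - j - k + s - 1))

noncomputable def HH (L i j k : ℤ) : RatFunc ℚ :=
  q ^ (T i + T j + T k) * (fq (L - k) * rq i * rq (L - k - i)) * (fq (L - i) * rq j * rq (L - i - j))
    * (fq (L - j) * rq k * rq (L - j - k))

theorem ww_i (L i j k s : ℤ) : ww L (i + 1) j k s = ww L i j k s + (i + 1 - s) := by
  unfold ww
  have := T_step (i - s)
  rw [show i + 1 - s = i - s + 1 by ring, this]; ring

theorem ww_s (L i j k s : ℤ) :
    ww L i j k (s + 1) = ww L i j k s + (L + 1 - i - j - k + 2 * s) := by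
  unfold ww
  have h0 := T_step s
  have h1 := T_step (i - (s + 1))
  have h2 := T_step (j - (s + 1))
  have h3 := T_step (k - (s + 1))
  rw [show i - (s + 1) + 1 = i - s by ring] at h1
  rw [show j - (s + 1) + 1 = j - s by ring] at h2
  rw [show k - (s + 1) + 1 = k - s by ring] at h3
  rw [h0, h1, h2, h3]; ring

theorem cert (L i j k s : ℤ) (hs : s ≤ L) :
    (1 - q ^ (i + 1)) * (1 - q ^ (L - i)) * tt L (i + 1) j k s
      - q ^ (i + 1) * (1 - q ^ (L - k - i)) * (1 - q ^ (L - i - j)) * tt L i j k s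
      = GG L i j k (s + 1) - GG L i j k s := by
  unfold tt GG
  rw [ww_i, ww_s]
  have e1 : fq (L + 1 - s) = (1 - q ^ (L + 1 - s)) * fq (L - s) := by
    have := fq_step (L - s) (by omega)
    rwa [show L - s + 1 = L + 1 - s by ring] at this
  have e2 : rq (s - 1) = (1 - q ^ s) * rq s := by
    have := rq_step (s - 1)
    rwa [show s - 1 + 1 = s by ring] at this
  have e3 : rq (i - s) = (1 - q ^ (i + 1 - s)) * rq (i + 1 - s) := by
    have := rq_step (i - s)
    rwa [show i - s + 1 = i + 1 - s by ring] at this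
  have e4 : rq (j - (s + 1)) = (1 - q ^ (j - s)) * rq (j - s) := by
    have := rq_step (j - (s + 1))
    rwa [show j - (s + 1) + 1 = j - s by ring] at this
  have e5 : rq (k - (s + 1)) = (1 - q ^ (k - s)) * rq (k - s) := by
    have := rq_step (k - (s + 1))
    rwa [show k - (s + 1) + 1 = k - s by ring] at this
  have e6 : rq (L - i - j - k + s - 1) = (1 - q ^ (L - i - j - k + s)) * rq (L - i - j - k + s) := by
    have := rq_step (L - i - j - k + s - 1)
    rwa [show L - i - j - k + s - 1 + 1 = L - i - j - k + s by ring] at this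
  rw [show L + 1 - (s + 1) = L - s by ring, show s + 1 - 1 = s by ring,
    show i + 1 - (s + 1) = i - s by ring,
    show L - i - j - k + (s + 1) - 1 = L - i - j - k + s by ring,
    show L - (i + 1) - j - k + s = L - i - j - k + s - 1 by ring,
    e1, e2, e3, e4, e5, e6]
  generalize fq (L - s) = F
  generalize rq s = r1
  generalize rq (i + 1 - s) = r2
  generalize rq (j - s) = r3
  generalize rq (k - s) = r4
  generalize rq (L - i - j - k + s) = r5
  have hq := q_ne0
  rw [show ww L i j k s + (L + 1 - i - j - k + 2 * s) + (i - s)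
    = ww L i j k s + (L + 1 - j - k + s) by ring]
  simp only [zpow_add₀ hq, zpow_sub₀ hq, zpow_one]
  generalize q ^ ww L i j k s = W
  have h1 : q ^ L ≠ 0 := zpow_ne_zero _ hq
  have h2 : q ^ i ≠ 0 := zpow_ne_zero _ hq
  have h3 : q ^ j ≠ 0 := zpow_ne_zero _ hq
  have h4 : q ^ k ≠ 0 := zpow_ne_zero _ hq
  have h5 : q ^ s ≠ 0 := zpow_ne_zero _ hq
  generalize q ^ L = x at *
  generalize q ^ i = a at *
  generalize q ^ j = b at *
  generalize q ^ k = c at *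
  generalize q ^ s = y at *
  generalize q = p at *
  field_simp
  ring

theorem HH_step (L i j k : ℤ) (hi : i + 1 ≤ L) :
    (1 - q ^ (i + 1)) * (1 - q ^ (L - i)) * HH L (i + 1) j k
      = q ^ (i + 1) * (1 - q ^ (L - k - i)) * (1 - q ^ (L - i - j)) * HH L i j k := by
  unfold HH
  have e1 := rq_step i
  have e2 := fq_step (L - (i + 1)) (by omega)
  rw [show L - (i + 1) + 1 = L - i by ring] at e2
  have e3 := rq_step (L - k - (i + 1))
  rw [show L - k - (i + 1) + 1 = L - k - i by ring] at e3
  have e4 := rq_step (L - (i + 1) - j)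
  rw [show L - (i + 1) - j + 1 = L - i - j by ring] at e4
  rw [e1, e2, e3, e4, T_step, show T i + i + 1 + T j + T k = T i + T j + T k + (i + 1) by ring,
    zpow_add₀ q_ne0 _ (i + 1)]
  ring

theorem sum_tt (j k L : ℕ) (i : ℕ) (h : i + j + k ≤ L) :
    ∑ s ∈ Finset.range (i + 1), tt L i j k s = HH L i j k := by
  induction i with
  | zero =>
    simp only [zero_add, Finset.sum_range_one, tt, HH, ww]
    have hT : T 0 = 0 := by simp [T]
    have hr : rq 0 = 1 := by simp [rq, fq]
    have h1 := rq_fq ((L : ℤ) - k) (by omega)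
    have h2 := rq_fq ((L : ℤ) - j) (by omega)
    simp only [Nat.cast_zero, sub_zero, zero_mul, hT, hr, zero_add, add_zero, mul_one]
    rw [show (L : ℤ) - j - k = (L : ℤ) - j - k from rfl]
    linear_combination
      (-(q ^ (T j + T k) * fq L * rq j * rq k * rq ((L : ℤ) - j - k)))
        * (h1 + h2 * (rq ((L : ℤ) - k) * fq ((L : ℤ) - k)))
  | succ i ih =>
    have ih := ih (by omega)
    have hc : ∀ s ∈ Finset.range (i + 1 + 1),
        (1 - q ^ ((i : ℤ) + 1)) * (1 - q ^ ((L : ℤ) - i)) * tt L (i + 1) j k s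
      - q ^ ((i : ℤ) + 1) * (1 - q ^ ((L : ℤ) - k - i)) * (1 - q ^ ((L : ℤ) - i - j)) * tt L i j k s
      = GG L i j k ((s + 1 : ℕ) : ℤ) - GG L i j k s := by
      intro s hs
      rw [Finset.mem_range] at hs
      have := cert L i j k s (by omega)
      rw [this]; push_cast; rfl
    have hsum := Finset.sum_congr rfl hc
    rw [Finset.sum_range_sub (fun s : ℕ => GG L i j k (s : ℤ)), Finset.sum_sub_distrib,
      ← Finset.mul_sum, ← Finset.mul_sum] at hsum
    have g1 : GG L i j k ((i + 1 + 1 : ℕ) : ℤ) = 0 := by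
      unfold GG
      rw [rq_neg ((i : ℤ) + 1 - ((i + 1 + 1 : ℕ) : ℤ)) (by omega)]; simp
    have g0 : GG L i j k ((0 : ℕ) : ℤ) = 0 := by
      unfold GG
      rw [rq_neg (((0 : ℕ) : ℤ) - 1) (by omega)]; simp
    have t0 : tt L i j k ((i + 1 : ℕ) : ℤ) = 0 := by
      unfold tt
      rw [rq_neg ((i : ℤ) - ((i + 1 : ℕ) : ℤ)) (by omega)]; simp
    rw [g1, g0, Finset.sum_range_succ (fun s : ℕ => tt L i j k s), t0, add_zero, ih,
      ← HH_step L i j k (by omega), sub_zero, ← mul_sub] at hsum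
    have ha : (1 - q ^ ((i : ℤ) + 1)) * (1 - q ^ ((L : ℤ) - i)) ≠ 0 :=
      mul_ne_zero (q_zpow_ne _ (by omega)) (q_zpow_ne _ (by omega))
    have := (mul_eq_zero.mp hsum).resolve_left ha
    push_cast
    exact sub_eq_zero.mp this

/-- The left side summand, `L` an arbitrary integer. -/
noncomputable def lhsT (i j k s : ℕ) (L : ℤ) : RatFunc ℚ :=
  q ^ ((s : ℤ) * (L + 2) - T s + T ((i : ℤ) - s) + T ((j : ℤ) - s) + T ((k : ℤ) - s)) *
          (qbin (L - s) s * qbin (L - 2 * s) ((i : ℤ) - s) *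
            qbin (L - s - i) ((j : ℤ) - s)) *
          qbin (L - i - j) ((k : ℤ) - s)

noncomputable def rhsT (i j k : ℕ) (L : ℤ) : RatFunc ℚ :=
  q ^ (T i + T j + T k) * qbin (L - k) i * qbin (L - i) j * qbin (L - j) k

theorem lhsT_eq (i j k s L : ℕ) (h : i + j + k ≤ L) : lhsT i j k s L = tt L i j k s := by
  unfold lhsT tt ww
  rcases Nat.lt_or_ge i s with hi | hi
  · rw [qbin_neg _ ((i : ℤ) - s) (by omega), rq_neg ((i : ℤ) - s) (by omega)]; simp
  rcases Nat.lt_or_ge j s with hj | hj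
  · rw [qbin_neg _ ((j : ℤ) - s) (by omega), rq_neg ((j : ℤ) - s) (by omega)]; simp
  rcases Nat.lt_or_ge k s with hk | hk
  · rw [qbin_neg _ ((k : ℤ) - s) (by omega), rq_neg ((k : ℤ) - s) (by omega)]; simp
  rw [qbin_eq _ _ (by omega), qbin_eq _ _ (by omega), qbin_eq _ _ (by omega),
    qbin_eq _ _ (by omega)]
  rw [show (L : ℤ) - s - s = L - 2 * s by ring,
    show (L : ℤ) - 2 * s - (i - s) = L - s - i by ring,
    show (L : ℤ) - s - i - (j - s) = L - i - j by ring,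
    show (L : ℤ) - i - j - (k - s) = L - i - j - k + s by ring]
  have h1 := rq_fq ((L : ℤ) - 2 * s) (by omega)
  have h2 := rq_fq ((L : ℤ) - s - i) (by omega)
  have h3 := rq_fq ((L : ℤ) - i - j) (by omega)
  generalize q ^ ((s : ℤ) * ((L : ℤ) + 2) - T s + T ((i : ℤ) - s) + T ((j : ℤ) - s)
    + T ((k : ℤ) - s)) = w
  generalize rq ((L : ℤ) - 2 * s) = a at *
  generalize fq ((L : ℤ) - 2 * s) = a2 at *
  generalize rq ((L : ℤ) - s - i) = b at *
  generalize fq ((L : ℤ) - s - i) = b2 at *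
  generalize rq ((L : ℤ) - i - j) = c at *
  generalize fq ((L : ℤ) - i - j) = c2 at *
  generalize fq ((L : ℤ) - s) = f
  generalize rq (s : ℤ) = r1
  generalize rq ((i : ℤ) - s) = r2
  generalize rq ((j : ℤ) - s) = r3
  generalize rq ((k : ℤ) - s) = r4
  generalize rq ((L : ℤ) - i - j - k + s) = r5
  calc _ = w * (f * r1 * r2 * r3 * r4 * r5) * (a * a2) * (b * b2) * (c * c2) := by ring
    _ = _ := by rw [h1, h2, h3]; ring

theorem big (i j k L : ℕ) (h : i + j + k ≤ L) :
    ∑ s ∈ Finset.range (i + 1), lhsT i j k s L = rhsT i j k L := by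
  rw [Finset.sum_congr rfl fun s _ => lhsT_eq i j k s L h, sum_tt j k L i h]
  unfold HH rhsT
  rw [qbin_eq _ _ (by omega), qbin_eq _ _ (by omega), qbin_eq _ _ (by omega)]

/-- polynomial in `q^L` -/
def IsP (f : ℤ → RatFunc ℚ) : Prop :=
  ∃ P : Polynomial (RatFunc ℚ), ∀ L, f L = P.eval (q ^ L)

theorem IsP.const (c : RatFunc ℚ) : IsP fun _ => c := ⟨Polynomial.C c, by simp⟩

theorem IsP.mul {f g : ℤ → RatFunc ℚ} (hf : IsP f) (hg : IsP g) : IsP fun L => f L * g L := by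
  obtain ⟨P, hP⟩ := hf
  obtain ⟨Q, hQ⟩ := hg
  exact ⟨P * Q, fun L => by
    change f L * g L = _
    rw [hP, hQ, Polynomial.eval_mul]⟩

theorem IsP.sum (n : ℕ) {f : ℕ → ℤ → RatFunc ℚ} (hf : ∀ s, IsP (f s)) :
    IsP fun L => ∑ s ∈ Finset.range n, f s L := by
  choose P hP using hf
  exact ⟨∑ s ∈ Finset.range n, P s, fun L => by
    rw [Polynomial.eval_finsetSum]; exact Finset.sum_congr rfl fun s _ => hP s L⟩

theorem IsP.prod (n : ℕ) {f : ℕ → ℤ → RatFunc ℚ} (hf : ∀ s, IsP (f s)) :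
    IsP fun L => ∏ s ∈ Finset.range n, f s L := by
  choose P hP using hf
  exact ⟨∏ s ∈ Finset.range n, P s, fun L => by
    rw [Polynomial.eval_prod]; exact Finset.prod_congr rfl fun s _ => hP s L⟩

theorem IsP.qbin (c n : ℤ) : IsP fun L => qbin (L - c) n := by
  unfold _root_.qbin
  split_ifs with h
  · exact IsP.const 0
  · apply IsP.prod
    intro s
    refine ⟨Polynomial.C (1 - q ^ ((s : ℤ) + 1))⁻¹ *
      (1 - Polynomial.C (q ^ (-c - s)) * Polynomial.X), fun L => ?_⟩
    simp only [Polynomial.eval_mul, Polynomial.eval_sub, Polynomial.eval_C, Polynomial.eval_X,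
      Polynomial.eval_one]
    rw [← zpow_add₀ q_ne0, div_eq_inv_mul, show -c - (s : ℤ) + L = L - c - s by ring]

theorem IsP.pw (s : ℕ) (c : ℤ) : IsP fun L => q ^ ((s : ℤ) * L + c) := by
  refine ⟨Polynomial.C (q ^ c) * Polynomial.X ^ s, fun L => ?_⟩
  simp only [Polynomial.eval_mul, Polynomial.eval_pow, Polynomial.eval_C, Polynomial.eval_X]
  rw [zpow_add₀ q_ne0, mul_comm (s : ℤ) L, zpow_mul, zpow_natCast, mul_comm]

theorem IsP.lhs (i j k s : ℕ) : IsP (lhsT i j k s) := by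
  have h := ((IsP.pw s (2 * s - T s + T ((i : ℤ) - s) + T ((j : ℤ) - s) + T ((k : ℤ) - s))).mul
    (((IsP.qbin s s).mul (IsP.qbin (2 * s) ((i : ℤ) - s))).mul
      (IsP.qbin (s + i) ((j : ℤ) - s)))).mul (IsP.qbin (i + j) ((k : ℤ) - s))
  convert h using 1
  funext L
  unfold lhsT
  rw [show L - ((s : ℤ) + i) = L - s - i by ring, show L - ((i : ℤ) + j) = L - i - j by ring]
  congr 3
  ring

theorem IsP.rhs (i j k : ℕ) : IsP (rhsT i j k) :=
  (((IsP.const _).mul (IsP.qbin k i)).mul (IsP.qbin i j)).mul (IsP.qbin j k)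

theorem q_inj : Function.Injective fun n : ℕ => q ^ n := by
  have key : ∀ a b : ℕ, a < b → q ^ a ≠ q ^ b := by
    intro a b hab h
    obtain ⟨c, rfl⟩ := Nat.exists_eq_add_of_lt hab
    rw [add_assoc, pow_add] at h
    exact q_pow_ne (c + 1) (by omega)
      (mul_left_cancel₀ (pow_ne_zero a q_ne0) (by rw [← h, mul_one]))
  intro a b h
  rcases lt_trichotomy a b with hab | hab | hab
  · exact absurd h (key a b hab)
  · exact hab
  · exact absurd h.symm (key b a hab)

theorem IsP.ext {f g : ℤ → RatFunc ℚ} (hf : IsP f) (hg : IsP g) (N : ℕ)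
    (h : ∀ L : ℕ, N ≤ L → f L = g L) (L : ℤ) : f L = g L := by
  obtain ⟨P, hP⟩ := hf
  obtain ⟨Q, hQ⟩ := hg
  have : P = Q := by
    apply Polynomial.eq_of_infinite_eval_eq
    have hinj : Function.Injective fun n : ℕ => q ^ (N + n) :=
      fun a b hab => by have := q_inj hab; omega
    refine (Set.infinite_range_of_injective hinj).mono ?_
    rintro _ ⟨n, rfl⟩
    have := h (N + n) (by omega)
    rw [hP, hQ, zpow_natCast] at this
    exact this
  rw [hP, hQ, this]

/-- Setting `L = M` and applying $q$-Pfaff–Saalschütz: the single sum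
(right-hand side of the double bounded identity with `L1 = L2 = M = L`)
evaluates in closed form.  Terms with `s > i` vanish since
`qbin (L - 2*s) (i - s) = 0` for `i - s < 0`. -/
theorem single_sum_evaluation (i j k L : ℕ) :
    ∑ s ∈ Finset.range (i + 1),
        q ^ ((s : ℤ) * ((L : ℤ) + 2) - T s + T ((i : ℤ) - s) + T ((j : ℤ) - s) + T ((k : ℤ) - s)) *
          (qbin ((L : ℤ) - s) s * qbin ((L : ℤ) - 2 * s) ((i : ℤ) - s) *
            qbin ((L : ℤ) - s - i) ((j : ℤ) - s)) *
          qbin ((L : ℤ) - i - j) ((k : ℤ) - s) =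
      q ^ (T i + T j + T k) * qbin ((L : ℤ) - k) i * qbin ((L : ℤ) - i) j *
        qbin ((L : ℤ) - j) k := by
  exact IsP.ext (IsP.sum (i + 1) (IsP.lhs i j k)) (IsP.rhs i j k) (i + j + k)
    (fun L hL => big i j k L hL) L
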